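/- Theorem 1 (representation-quality bound on value differences): let S be a measurable space, let Z be a metric space with metric d_Z equipped with its Borel σ-algebra, let A be a measurable space, and let γ ∈ [0,1). Let P be a Markov kernel from S × A to S and P̄ a Markov kernel from Z × A to Z; let R : S × A → ℝ and R̄ : Z × A → ℝ be bounded measurable reward functions; let φ : S → Z be a measurable embedding map; and let π̄ be a Markov kernel from Z to A (a latent policy). Let Q : S × A → ℝ and Q̄ : Z × A → ℝ be bounded measurable functions satisfying the Bellman equations Q(s,a) = R(s,a) + γ ∫_S ∫_A Q(s',a') π̄(da'|φ(s')) P(ds'|s,a) and Q̄(z,a) = R̄(z,a) + γ ∫_Z ∫_A Q̄(z',a') π̄(da'|z') P̄(dz'|z,a), and define V̄(z) = ∫_A Q̄(z,a) π̄(da|z). Suppose: (i) V̄ is Lipschitz with constant K_V̄ ≥ 0 and, for every fixed a ∈ A, the map z ↦ Q̄(z,a) is Lipschitz with constant K_V̄; (ii) there is a constant L_R ≥ 0 with |R(s,a) − R̄(φ(s),a)| ≤ L_R for all s ∈ S, a ∈ A; (iii) there is a constant L_P ≥ 0 such that for every 1-Lipschitz function f : Z → ℝ and all s ∈ S, a ∈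 A one has |∫_S f(φ(s')) P(ds'|s,a) − ∫_Z f(z') P̄(dz'|φ(s),a)| ≤ L_P. Then for all s₁, s₂ ∈ S and all a ∈ A, |Q(s₁,a) − Q(s₂,a)| ≤ K_V̄ · d_Z(φ(s₁), φ(s₂)) + 2(L_R + γ K_V̄ L_P)/(1 − γ). -/

import Mathlib

open MeasureTheory ProbabilityTheory

/-- A bounded function all of whose upper bounds improve under `D ↦ c + γ * D` is at most the
fixed point `c / (1 - γ)`. -/
theorem le_div_one_sub_of_upperBounds_contract {ι : Type*} {f : ι → ℝ} {c γ : ℝ} (hγ : γ < 1)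
    (hf : BddAbove (Set.range f))
    (h : ∀ D, (∀ i, f i ≤ D) → ∀ i, f i ≤ c + γ * D) (i : ι) :
    f i ≤ c / (1 - γ) := by
  have : Nonempty ι := ⟨i⟩
  have hsup : ⨆ j, f j ≤ c + γ * ⨆ j, f j := ciSup_le (h _ (le_ciSup hf))
  refine (le_ciSup hf i).trans ?_
  rw [le_div_iff₀ (sub_pos.2 hγ)]
  linarith

/-- A Kantorovich-dual bound on `1`-Lipschitz functions scales to `K`-Lipschitz functions. -/
theorem abs_integral_comp_sub_integral_le_of_lipschitzWith {S Z : Type*} [MeasurableSpace S]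
    [PseudoMetricSpace Z] [MeasurableSpace Z] {μ : Measure S} [IsProbabilityMeasure μ]
    {ν : Measure Z} [IsProbabilityMeasure ν] {φ : S → Z} {L : ℝ}
    (h : ∀ f : Z → ℝ, LipschitzWith 1 f → |(∫ s, f (φ s) ∂μ) - ∫ z, f z ∂ν| ≤ L)
    {K : ℝ} (hK : 0 ≤ K) {g : Z → ℝ} (hg : LipschitzWith K.toNNReal g) :
    |(∫ s, g (φ s) ∂μ) - ∫ z, g z ∂ν| ≤ K * L := by
  have hdist (x y : Z) : |g x - g y| ≤ K * dist x y := by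
    simpa [Real.dist_eq, hK] using hg.dist_le_mul x y
  rcases hK.eq_or_lt with rfl | hK
  · obtain ⟨z₀⟩ := nonempty_of_isProbabilityMeasure ν
    have hconst (z : Z) : g z = g z₀ := by
      have := hdist z z₀
      rw [zero_mul, abs_nonpos_iff] at this
      linarith
    simp [hconst]
  · have hlip : LipschitzWith 1 fun z => K⁻¹ * g z := by
      refine LipschitzWith.of_dist_le_mul fun x y => ?_
      rw [Real.dist_eq, ← mul_sub, abs_mul, abs_of_pos (inv_pos.2 hK), inv_mul_le_iff₀ hK]
      simpa using hdist x y
    have := h _ hlip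
    rwa [integral_const_mul, integral_const_mul, ← mul_sub, abs_mul,
      abs_of_pos (inv_pos.2 hK), inv_mul_le_iff₀ hK] at this

/-- Integrals of bounded measurable functions against a probability measure that differ by at most
`D` pointwise differ by at most `D`. -/
theorem abs_integral_sub_integral_le_of_abs_sub_le {α : Type*} [MeasurableSpace α]
    {μ : Measure α} [IsProbabilityMeasure μ] {f g : α → ℝ} (hf : Integrable f μ)
    (hg : Integrable g μ) {D : ℝ} (h : ∀ x, |f x - g x| ≤ D) :
    |(∫ x, f x ∂μ) - ∫ x, g x ∂μ| ≤ D := by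
  rw [← integral_sub hf hg]
  simpa using norm_integral_le_of_norm_le_const (μ := μ) (f := fun x => f x - g x)
    (Filter.Eventually.of_forall h)

/-- Theorem 1 (representation-quality bound on value differences):
`|Q(s₁,a) − Q(s₂,a)| ≤ K_V̄ d_Z(φ(s₁), φ(s₂)) + 2(L_R + γ K_V̄ L_P)/(1 − γ)`. -/
theorem deepmdp_representation_quality_bound
    {S Z A : Type*} [MeasurableSpace S]
    [MetricSpace Z] [MeasurableSpace Z] [BorelSpace Z] [MeasurableSpace A]
    (γ : ℝ) (hγ0 : 0 ≤ γ) (hγ1 : γ < 1)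
    (P : Kernel (S × A) S) [IsMarkovKernel P]
    (Pbar : Kernel (Z × A) Z) [IsMarkovKernel Pbar]
    (R : S × A → ℝ) (hRmeas : Measurable R) (hRbdd : ∃ C : ℝ, ∀ x, |R x| ≤ C)
    (Rbar : Z × A → ℝ) (hRbarMeas : Measurable Rbar)
    (hRbarBdd : ∃ C : ℝ, ∀ x, |Rbar x| ≤ C)
    (φ : S → Z) (hφ : Measurable φ)
    (πbar : Kernel Z A) [IsMarkovKernel πbar]
    (Q : S × A → ℝ) (hQmeas : Measurable Q) (hQbdd : ∃ C : ℝ, ∀ x, |Q x| ≤ C)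
    (Qbar : Z × A → ℝ) (hQbarMeas : Measurable Qbar)
    (hQbarBdd : ∃ C : ℝ, ∀ x, |Qbar x| ≤ C)
    (hQbell : ∀ s a, Q (s, a) =
      R (s, a) + γ * ∫ s', ∫ a', Q (s', a') ∂(πbar (φ s')) ∂(P (s, a)))
    (hQbarBell : ∀ z a, Qbar (z, a) =
      Rbar (z, a) + γ * ∫ z', ∫ a', Qbar (z', a') ∂(πbar z') ∂(Pbar (z, a)))
    (Vbar : Z → ℝ) (hVbar : ∀ z, Vbar z = ∫ a, Qbar (z, a) ∂(πbar z))
    (KV : ℝ) (hKV0 : 0 ≤ KV) (hVbarLip : LipschitzWith KV.toNNReal Vbar)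
    (hQbarLip : ∀ a : A, LipschitzWith KV.toNNReal (fun z => Qbar (z, a)))
    (LR : ℝ) (hLR0 : 0 ≤ LR) (hLR : ∀ s a, |R (s, a) - Rbar (φ s, a)| ≤ LR)
    (LP : ℝ) (hLP0 : 0 ≤ LP)
    (hLP : ∀ f : Z → ℝ, LipschitzWith 1 f → ∀ s a,
      |(∫ s', f (φ s') ∂(P (s, a))) - ∫ z', f z' ∂(Pbar (φ s, a))| ≤ LP) :
    ∀ s₁ s₂ a, |Q (s₁, a) - Q (s₂, a)| ≤
      KV * dist (φ s₁) (φ s₂) + 2 * (LR + γ * KV * LP) / (1 - γ) := by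
  obtain ⟨C, hC⟩ := hQbdd
  obtain ⟨C', hC'⟩ := hQbarBdd
  have hQint (s : S) : Integrable (fun a => Q (s, a)) (πbar (φ s)) :=
    .of_bound (hQmeas.comp measurable_prodMk_left).aestronglyMeasurable C
      (.of_forall fun a => hC (s, a))
  have hQbarInt (z : Z) : Integrable (fun a => Qbar (z, a)) (πbar z) :=
    .of_bound (hQbarMeas.comp measurable_prodMk_left).aestronglyMeasurable C'
      (.of_forall fun a => hC' (z, a))
  have hVmeas : StronglyMeasurable fun s => ∫ a, Q (s, a) ∂(πbar (φ s)) :=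
    hQmeas.stronglyMeasurable.integral_kernel_prod_right' (κ := πbar.comap φ hφ)
  have hVint (x : S × A) : Integrable (fun s => ∫ a, Q (s, a) ∂(πbar (φ s))) (P x) :=
    .of_bound hVmeas.aestronglyMeasurable C (.of_forall fun s => by
      simpa using norm_integral_le_of_norm_le_const (μ := πbar (φ s))
        (f := fun a => Q (s, a)) (.of_forall fun a => hC (s, a)))
  have hVbarInt (x : S × A) : Integrable (fun s => Vbar (φ s)) (P x) :=
    .of_bound (hVbarLip.continuous.measurable.comp hφ).aestronglyMeasurable C'
      (.of_forall fun s => by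
        simpa [hVbar] using norm_integral_le_of_norm_le_const (μ := πbar (φ s))
          (f := fun a => Qbar (φ s, a)) (.of_forall fun a => hC' (φ s, a)))
  have transfer (x : S × A) :
      |Q x - Qbar (φ x.1, x.2)| ≤ (LR + γ * KV * LP) / (1 - γ) := by
    refine le_div_one_sub_of_upperBounds_contract
      (f := fun x : S × A => |Q x - Qbar (φ x.1, x.2)|) hγ1 ⟨C + C', ?_⟩ ?_ x
    · rintro _ ⟨y, rfl⟩
      exact (abs_sub _ _).trans (add_le_add (hC _) (hC' _))
    · rintro D hD ⟨s, a⟩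
      have hV : |(∫ s', ∫ a', Q (s', a') ∂(πbar (φ s')) ∂(P (s, a))) -
          ∫ s', Vbar (φ s') ∂(P (s, a))| ≤ D :=
        abs_integral_sub_integral_le_of_abs_sub_le (hVint _) (hVbarInt _) fun s' => by
          rw [hVbar]
          exact abs_integral_sub_integral_le_of_abs_sub_le (hQint s') (hQbarInt (φ s'))
            fun a' => hD (s', a')
      have hW := abs_integral_comp_sub_integral_le_of_lipschitzWith
        (fun f hf => hLP f hf s a) hKV0 hVbarLip
      have hdiff := mul_le_mul_of_nonneg_left
        ((abs_sub_le _ _ _).trans (add_le_add hV hW)) hγ0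
      have hbar := hQbarBell (φ s) a
      simp only [← hVbar] at hbar
      dsimp only
      rw [hQbell, hbar, add_sub_add_comm, ← mul_sub]
      refine (abs_add_le _ _).trans ?_
      rw [abs_mul, abs_of_nonneg hγ0]
      linarith [hLR s a]
  intro s₁ s₂ a
  have hlip : |Qbar (φ s₁, a) - Qbar (φ s₂, a)| ≤ KV * dist (φ s₁) (φ s₂) := by
    simpa [Real.dist_eq, hKV0] using (hQbarLip a).dist_le_mul (φ s₁) (φ s₂)
  have h₁ := abs_le.1 (transfer (s₁, a))
  have h₂ := abs_le.1 (transfer (s₂, a))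
  have h₃ := abs_le.1 hlip
  rw [mul_div_assoc, abs_le]
  constructor <;> linarith
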